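/- Let Ω ⊆ ℝ^d be a bounded Lebesgue measurable set with |Ω| > 0, let a₁, …, a_m ∈ ℝ^d, and let 0 < A ≤ B < ∞. Then the family of exponentials {x ↦ e^{2πi⟨a_j+λ, x⟩} restricted to Ω : 1 ≤ j ≤ m, λ ∈ ℤ^d} is a frame of L²(Ω) with frame bounds A and B if and only if for almost every ω ∈ [0,1)^d and every finitely supported c : ℤ^d → ℂ with c_k = 0 whenever ω + k ∉ Ω, one has A ∑_{k∈ℤ^d} |c_k|² ≤ ∑_{j=1}^m \Big| ∑_{k∈ℤ^d} c_k e^{-2πi⟨a_j, k⟩} \Big|² ≤ B ∑_{k∈ℤ^d} |c_k|². -/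

import Mathlib

open MeasureTheory ENNReal

/-- A family `φ i : α → ℂ` of functions is a frame for `L²(μ)` with frame bounds `A ≤ B`. -/
def IsFrameWith {α : Type*} [MeasurableSpace α] (μ : Measure α) {I : Type*}
    (φ : I → α → ℂ) (A B : ℝ) : Prop :=
  ∀ f : Lp ℂ 2 μ,
    A * ‖f‖ ^ 2 ≤ (∑' i : I, ‖∫ x, f x * (starRingEnd ℂ) (φ i x) ∂μ‖ ^ 2) ∧
    (∑' i : I, ‖∫ x, f x * (starRingEnd ℂ) (φ i x) ∂μ‖ ^ 2) ≤ B * ‖f‖ ^ 2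

/-- The exponential `x ↦ e^{2πi⟨b, x⟩}` on `ℝ^d`. -/
noncomputable def expChar {d : ℕ} (b : Fin d → ℝ) : (Fin d → ℝ) → ℂ :=
  fun x => Complex.exp (2 * Real.pi * Complex.I * (∑ i, b i * x i))

/-- The fundamental domain `[0,1)^d` of `ℤ^d` in `ℝ^d`. -/
def unitBox (d : ℕ) : Set (Fin d → ℝ) := Set.univ.pi fun _ => Set.Ico (0 : ℝ) 1

/-- The normalized Haar measure on `ℝ / ℤ`, as in Mathlib's treatment of multivariate Fourier
series. -/
noncomputable local instance : MeasureSpace UnitAddCircle := ⟨AddCircle.haarAddCircle⟩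

theorem unitBox_ae_eq_pi_Ioc (d : ℕ) :
    (unitBox d : Set (Fin d → ℝ)) =ᵐ[volume]
      {x : Fin d → ℝ | ∀ i, x i ∈ Set.Ioc ((0 : Fin d → ℝ) i) ((0 : Fin d → ℝ) i + 1)} := by
  have h := (Measure.univ_pi_Ico_ae_eq_Icc (μ := fun _ : Fin d => (volume : Measure ℝ))
    (f := 0) (g := 1)).trans (Measure.univ_pi_Ioc_ae_eq_Icc
    (μ := fun _ : Fin d => (volume : Measure ℝ)) (f := 0) (g := 1)).symm
  have hP : {x : Fin d → ℝ | ∀ i, x i ∈ Set.Ioc ((0 : Fin d → ℝ) i) ((0 : Fin d → ℝ) i + 1)} =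
      Set.univ.pi fun i => Set.Ioc ((0 : Fin d → ℝ) i) ((1 : Fin d → ℝ) i) := by
    ext x; simp [Set.mem_pi]
  rw [hP]
  exact h

theorem conj_expChar {d : ℕ} (b x : Fin d → ℝ) :
    (starRingEnd ℂ) (expChar b x) = expChar (-b) x := by
  simp only [expChar, ← Complex.exp_conj, map_mul, Complex.conj_ofReal, Complex.conj_I,
    map_ofNat, Pi.neg_apply, Complex.ofReal_neg, neg_mul, Finset.sum_neg_distrib]
  congr 1; ring

theorem norm_expChar {d : ℕ} (b x : Fin d → ℝ) : ‖expChar b x‖ = 1 := by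
  have : (2 * Real.pi * Complex.I * ((∑ i, b i * x i : ℝ) : ℂ)) =
      ((2 * Real.pi * ∑ i, b i * x i : ℝ) : ℂ) * Complex.I := by
    push_cast; ring
  rw [expChar, this, Complex.norm_exp_ofReal_mul_I]

theorem continuous_expChar {d : ℕ} (b : Fin d → ℝ) : Continuous (expChar b) := by
  unfold expChar; fun_prop

theorem mFourier_coe_eq_expChar {d : ℕ} (l : Fin d → ℤ) (x : Fin d → ℝ) :
    UnitAddTorus.mFourier l (fun i => (x i : UnitAddCircle)) =
      expChar (fun i => (l i : ℝ)) x := by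
  simp only [UnitAddTorus.mFourier, ContinuousMap.coe_mk, fourier_coe_apply, expChar,
    ← Complex.exp_sum]
  congr 1
  push_cast
  rw [Finset.mul_sum]
  refine Finset.sum_congr rfl fun i _ => ?_
  ring

/-- Parseval's identity for Fourier series of square-integrable functions on the unit box. -/
theorem hasSum_sq_integral_expChar {d : ℕ} {g : (Fin d → ℝ) → ℂ}
    (hg : MemLp g 2 (volume.restrict (unitBox d))) :
    HasSum (fun l : Fin d → ℤ =>
        ‖∫ x in unitBox d, g x * (starRingEnd ℂ) (expChar (fun i => (l i : ℝ)) x)‖ ^ 2)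
      (∫ x in unitBox d, ‖g x‖ ^ 2) := by
  have hbox := unitBox_ae_eq_pi_Ioc d
  simp only [Measure.restrict_congr_set hbox] at hg ⊢
  set P : Set (Fin d → ℝ) :=
    {x | ∀ i, x i ∈ Set.Ioc ((0 : Fin d → ℝ) i) ((0 : Fin d → ℝ) i + 1)} with hP
  have hPm : MeasurableSet P := MeasurableSet.univ_pi' fun _ => measurableSet_Ioc
  let e := UnitAddTorus.measurableEquivPiIoc (0 : Fin d → ℝ)
  let G : UnitAddTorus (Fin d) → ℂ := fun t => g (e t).1
  have hG_coe : ∀ x ∈ P, G (fun i => (x i : UnitAddCircle)) = g x := by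
    intro x hx
    have := e.apply_symm_apply ⟨x, hx⟩
    exact congrArg (fun y => g y.1) this
  have hG : MemLp G 2 volume := by
    have h1 : MemLp (fun y : P => g y.1) 2 (Measure.comap Subtype.val volume) := by
      rw [← map_comap_subtype_coe hPm] at hg
      exact ((MeasurableEmbedding.subtype_coe hPm).memLp_map_measure_iff).1 hg
    exact h1.comp_measurePreserving (UnitAddTorus.measurePreserving_equivPiIoc 0)
  have h := UnitAddTorus.hasSum_sq_mFourierCoeff (hG.toLp G)
  have hae : hG.toLp G =ᵐ[volume] G := hG.coeFn_toLp
  convert h using 1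
  · ext l
    have : UnitAddTorus.mFourierCoeff (hG.toLp G) l = UnitAddTorus.mFourierCoeff G l :=
      integral_congr_ae (hae.mono fun t ht => by simp only [ht])
    rw [this, UnitAddTorus.mFourierCoeff_eq_integral G l 0]
    congr 2
    refine setIntegral_congr_fun hPm fun x hx => ?_
    simp only [hG_coe x hx, UnitAddTorus.mFourier_neg, mFourier_coe_eq_expChar, smul_eq_mul]
    ring
  · have : ∫ t, ‖hG.toLp G t‖ ^ 2 = ∫ t, ‖G t‖ ^ 2 :=
      integral_congr_ae (hae.mono fun t ht => by simp only [ht])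
    rw [this, UnitAddTorus.integral_preimage _ 0]
    refine setIntegral_congr_fun hPm fun x hx => ?_
    simp only [hG_coe x hx]

/-- The integer translate of the unit box whose lower corner is `k`. -/
def intCube {d : ℕ} (k : Fin d → ℤ) : Set (Fin d → ℝ) := {x | (fun i => ⌊x i⌋) = k}

theorem measurable_pi_floor (d : ℕ) : Measurable fun x : Fin d → ℝ => fun i => ⌊x i⌋ :=
  measurable_pi_lambda _ fun i => Int.measurable_floor.comp (measurable_pi_apply i)

theorem measurableSet_intCube {d : ℕ} (k : Fin d → ℤ) : MeasurableSet (intCube k) :=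
  measurable_pi_floor d (measurableSet_singleton k)

theorem intCube_zero (d : ℕ) : intCube (0 : Fin d → ℤ) = unitBox d := by
  ext x
  simp [intCube, unitBox, Set.mem_pi, funext_iff, Int.floor_eq_zero_iff]

theorem measurableSet_unitBox (d : ℕ) : MeasurableSet (unitBox d) :=
  intCube_zero d ▸ measurableSet_intCube 0

theorem volume_unitBox_lt_top (d : ℕ) : volume (unitBox d) < ∞ := by
  simp [unitBox, volume_pi_pi]

theorem floor_add_intCast_of_mem_unitBox {d : ℕ} {x : Fin d → ℝ} (hx : x ∈ unitBox d)
    (k : Fin d → ℤ) : (fun i => ⌊x i + (k i : ℝ)⌋) = k := by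
  rw [← intCube_zero] at hx
  ext i
  simpa using congrFun hx i

/-- Translation by an integer vector. -/
def intShift {d : ℕ} (k : Fin d → ℤ) (x : Fin d → ℝ) : Fin d → ℝ := fun i => x i + (k i : ℝ)

theorem measurePreserving_intShift {d : ℕ} (k : Fin d → ℤ) :
    MeasurePreserving (intShift k) volume volume :=
  measurePreserving_add_right volume (fun i => (k i : ℝ))

theorem measurableEmbedding_intShift {d : ℕ} (k : Fin d → ℤ) :
    MeasurableEmbedding (intShift k) :=
  measurableEmbedding_addRight (fun i => (k i : ℝ))

theorem intShift_preimage_intCube {d : ℕ} (k : Fin d → ℤ) :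
    intShift k ⁻¹' intCube k = unitBox d := by
  rw [← intCube_zero]
  ext x
  simp [intShift, intCube, funext_iff]

theorem measurePreserving_intShift_restrict {d : ℕ} (k : Fin d → ℤ) :
    MeasurePreserving (intShift k) (volume.restrict (unitBox d))
      (volume.restrict (intCube k)) := by
  rw [← intShift_preimage_intCube k]
  exact (measurePreserving_intShift k).restrict_preimage (measurableSet_intCube k)

theorem setIntegral_intCube {d : ℕ} {E : Type*} [NormedAddCommGroup E] [NormedSpace ℝ E]
    (k : Fin d → ℤ) (h : (Fin d → ℝ) → E) :
    ∫ x in intCube k, h x = ∫ x in unitBox d, h (intShift k x) :=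
  ((measurePreserving_intShift_restrict k).integral_comp
    (measurableEmbedding_intShift k) h).symm

/-- Integration over `ℝ^d` by summing over integer translates of the unit box. -/
theorem integral_eq_setIntegral_unitBox_sum {d : ℕ} {E : Type*} [NormedAddCommGroup E]
    [NormedSpace ℝ E] {h : (Fin d → ℝ) → E} (hi : Integrable h) {K : Finset (Fin d → ℤ)}
    (hK : ∀ x, (fun i => ⌊x i⌋) ∉ K → h x = 0) :
    ∫ x, h x = ∫ x in unitBox d, ∑ k ∈ K, h (intShift k x) := by
  have h1 : ∫ x, h x = ∫ x in ⋃ k ∈ K, intCube k, h x := by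
    refine (setIntegral_eq_integral_of_forall_compl_eq_zero fun x hx => hK x fun hx' => hx ?_).symm
    exact Set.mem_biUnion hx' rfl
  rw [h1, integral_biUnion_finset K (fun k _ => measurableSet_intCube k) _
    fun k _ => hi.integrableOn]
  · rw [integral_finsetSum]
    · exact Finset.sum_congr rfl fun k _ => setIntegral_intCube k h
    · intro k _
      exact (measurePreserving_intShift_restrict k).integrable_comp_of_integrable hi.integrableOn
  · intro k _ l _ hkl
    exact Set.disjoint_left.2 fun x hx hx' => hkl (hx.symm.trans hx')

theorem exists_finset_floor_mem {d : ℕ} {Ω : Set (Fin d → ℝ)} (hΩ : Bornology.IsBounded Ω) :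
    ∃ K : Finset (Fin d → ℤ), ∀ x ∈ Ω, (fun i => ⌊x i⌋) ∈ K := by
  obtain ⟨R, hR⟩ := hΩ.exists_norm_le
  refine ⟨Finset.Icc (fun _ => ⌊-R⌋) (fun _ => ⌊R⌋), fun x hx => Finset.mem_Icc.2 ⟨?_, ?_⟩⟩ <;>
  · intro i
    have := abs_le.1 ((norm_le_pi_norm x i).trans (hR x hx))
    exact Int.floor_le_floor (by linarith)

theorem expChar_add {d : ℕ} (b c x : Fin d → ℝ) :
    expChar (b + c) x = expChar b x * expChar c x := by
  simp only [expChar, ← Complex.exp_add, Pi.add_apply, add_mul, Finset.sum_add_distrib,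
    Complex.ofReal_add, mul_add]

theorem expChar_intShift {d : ℕ} (b x : Fin d → ℝ) (k : Fin d → ℤ) :
    expChar b (intShift k x) = expChar b x * expChar b (fun i => (k i : ℝ)) := by
  simp only [expChar, ← Complex.exp_add, intShift, mul_add, Finset.sum_add_distrib,
    Complex.ofReal_add]

theorem expChar_intCast_intCast {d : ℕ} (l k : Fin d → ℤ) :
    expChar (fun i => (l i : ℝ)) (fun i => (k i : ℝ)) = 1 := by
  rw [expChar, Complex.exp_eq_one_iff]
  refine ⟨∑ i, l i * k i, ?_⟩
  push_cast; ring

/-- The squared norm of `(∑ₖ cₖ e^{-2πi⟨a_j,k⟩})_j`, with `k` ranging over `K`. -/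
noncomputable def fiberNormSq {d m : ℕ} (a : Fin m → Fin d → ℝ) (K : Finset (Fin d → ℤ))
    (c : (Fin d → ℤ) → ℂ) : ℝ :=
  ∑ j : Fin m, ‖∑ k ∈ K,
    c k * Complex.exp (-(2 * Real.pi * Complex.I * (∑ i, a j i * (k i : ℝ) : ℝ)))‖ ^ 2

theorem norm_sum_mul_conj_expChar_intShift {d : ℕ} (K : Finset (Fin d → ℤ))
    (c : (Fin d → ℤ) → ℂ) (b x : Fin d → ℝ) :
    ‖∑ k ∈ K, c k * (starRingEnd ℂ) (expChar b (intShift k x))‖ =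
      ‖∑ k ∈ K, c k *
        Complex.exp (-(2 * Real.pi * Complex.I * (∑ i, b i * (k i : ℝ) : ℝ)))‖ := by
  have h : ∑ k ∈ K, c k * (starRingEnd ℂ) (expChar b (intShift k x)) =
      expChar (-b) x * ∑ k ∈ K, c k *
        Complex.exp (-(2 * Real.pi * Complex.I * (∑ i, b i * (k i : ℝ) : ℝ))) := by
    rw [Finset.mul_sum]
    refine Finset.sum_congr rfl fun k _ => ?_
    rw [conj_expChar, expChar_intShift, mul_left_comm]
    congr 2
    simp [expChar]
  rw [h, norm_mul, norm_expChar, one_mul]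

theorem MeasureTheory.MemLp.comp_intShift {d : ℕ} {F : (Fin d → ℝ) → ℂ} (hF : MemLp F 2)
    (k : Fin d → ℤ) : MemLp (fun x => F (intShift k x)) 2 (volume.restrict (unitBox d)) :=
  (hF.restrict (intCube k)).comp_measurePreserving (measurePreserving_intShift_restrict k)

theorem MeasureTheory.MemLp.mul_conj_expChar {d : ℕ} {μ : Measure (Fin d → ℝ)} {p : ℝ≥0∞}
    {F : (Fin d → ℝ) → ℂ} (hF : MemLp F p μ) (b : Fin d → ℝ) :
    MemLp (fun x => F x * (starRingEnd ℂ) (expChar b x)) p μ := by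
  refine hF.of_le (hF.1.mul ?_) (.of_forall fun x => ?_)
  · exact (Complex.continuous_conj.comp (continuous_expChar b)).aestronglyMeasurable
  · simp [norm_expChar]

theorem memLp_sum_mul_conj_expChar {d : ℕ} {F : (Fin d → ℝ) → ℂ} (hF : MemLp F 2)
    (K : Finset (Fin d → ℤ)) (b : Fin d → ℝ) :
    MemLp (fun x => ∑ k ∈ K, F (intShift k x) * (starRingEnd ℂ) (expChar b (intShift k x))) 2
      (volume.restrict (unitBox d)) :=
  memLp_finsetSum K fun k _ => (hF.mul_conj_expChar b).comp_intShift k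

theorem integrableOn_norm_sum_intShift_sq {d : ℕ} {F : (Fin d → ℝ) → ℂ} (hF : MemLp F 2)
    (K : Finset (Fin d → ℤ)) (b : Fin d → ℝ) :
    IntegrableOn (fun x => ‖∑ k ∈ K, F (intShift k x) *
      Complex.exp (-(2 * Real.pi * Complex.I * (∑ i, b i * (k i : ℝ) : ℝ)))‖ ^ 2) (unitBox d) :=
  (memLp_sum_mul_conj_expChar hF K b).norm.integrable_sq.congr (.of_forall fun x => by
    simp only [norm_sum_mul_conj_expChar_intShift K (fun k => F (intShift k x))])

theorem integrableOn_fiberNormSq {d m : ℕ} {F : (Fin d → ℝ) → ℂ} (hF : MemLp F 2)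
    (K : Finset (Fin d → ℤ)) (a : Fin m → Fin d → ℝ) :
    IntegrableOn (fun x => fiberNormSq a K fun k => F (intShift k x)) (unitBox d) :=
  integrable_finsetSum _ fun j _ => integrableOn_norm_sum_intShift_sq hF K (a j)

theorem hasSum_sq_integral_mul_expChar {d : ℕ} {F : (Fin d → ℝ) → ℂ} (hF : MemLp F 2)
    (hFi : Integrable F) {K : Finset (Fin d → ℤ)} (hK : ∀ x, (fun i => ⌊x i⌋) ∉ K → F x = 0)
    (b : Fin d → ℝ) :
    HasSum (fun l : Fin d → ℤ =>
        ‖∫ x, F x * (starRingEnd ℂ) (expChar (b + fun i => (l i : ℝ)) x)‖ ^ 2)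
      (∫ x in unitBox d, ‖∑ k ∈ K, F (intShift k x) *
        Complex.exp (-(2 * Real.pi * Complex.I * (∑ i, b i * (k i : ℝ) : ℝ)))‖ ^ 2) := by
  have h := hasSum_sq_integral_expChar (memLp_sum_mul_conj_expChar hF K b)
  simp only [fun x => norm_sum_mul_conj_expChar_intShift K (fun k => F (intShift k x)) b x] at h
  convert h using 4 with l
  rw [integral_eq_setIntegral_unitBox_sum (K := K)]
  · refine integral_congr_ae (.of_forall fun x => ?_)
    simp only [Finset.sum_mul]
    refine Finset.sum_congr rfl fun k _ => ?_
    rw [expChar_add, expChar_intShift (fun i => (l i : ℝ)), expChar_intCast_intCast, mul_one,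
      map_mul, mul_assoc]
  · exact memLp_one_iff_integrable.1 ((memLp_one_iff_integrable.2 hFi).mul_conj_expChar _)
  · intro x hx
    rw [hK x hx, zero_mul]

theorem tsum_sq_integral_mul_expChar {d m : ℕ} {F : (Fin d → ℝ) → ℂ} (hF : MemLp F 2)
    (hFi : Integrable F) {K : Finset (Fin d → ℤ)} (hK : ∀ x, (fun i => ⌊x i⌋) ∉ K → F x = 0)
    (a : Fin m → Fin d → ℝ) :
    ∑' p : Fin m × (Fin d → ℤ),
        ‖∫ x, F x * (starRingEnd ℂ) (expChar (a p.1 + fun i => (p.2 i : ℝ)) x)‖ ^ 2 =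
      ∫ x in unitBox d, fiberNormSq a K fun k => F (intShift k x) := by
  have h := fun j => hasSum_sq_integral_mul_expChar hF hFi hK (a j)
  rw [Summable.tsum_prod, tsum_fintype]
  · simp_rw [fun j => (h j).tsum_eq, fiberNormSq]
    exact (integral_finsetSum _ fun j _ => integrableOn_norm_sum_intShift_sq hF K (a j)).symm
  · refine (summable_prod_of_nonneg fun p => by positivity).2 ⟨fun j => (h j).summable, ?_⟩
    exact Summable.of_finite

theorem integral_sq_norm_eq_sum_intShift {d : ℕ} {F : (Fin d → ℝ) → ℂ} (hF : MemLp F 2)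
    {K : Finset (Fin d → ℤ)} (hK : ∀ x, (fun i => ⌊x i⌋) ∉ K → F x = 0) :
    ∫ x, ‖F x‖ ^ 2 = ∫ x in unitBox d, ∑ k ∈ K, ‖F (intShift k x)‖ ^ 2 :=
  integral_eq_setIntegral_unitBox_sum hF.norm.integrable_sq fun x hx => by simp [hK x hx]

theorem MeasureTheory.MemLp.norm_toLp_sq {α : Type*} [MeasurableSpace α] {μ : Measure α}
    {f : α → ℂ} (hf : MemLp f 2 μ) : ‖hf.toLp f‖ ^ 2 = ∫ x, ‖f x‖ ^ 2 ∂μ := by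
  rw [Lp.norm_toLp, MemLp.eLpNorm_eq_integral_rpow_norm two_ne_zero ENNReal.ofNat_ne_top hf,
    ENNReal.toReal_ofReal (by positivity), ← Real.rpow_natCast, ← Real.rpow_mul (by positivity)]
  simp

theorem fiberNormSq_eq_of_support_subset {d m : ℕ} (a : Fin m → Fin d → ℝ)
    (c : (Fin d → ℤ) →₀ ℂ) {K : Finset (Fin d → ℤ)} (hK : c.support ⊆ K) :
    fiberNormSq a c.support c = fiberNormSq a K c := by
  unfold fiberNormSq
  refine Finset.sum_congr rfl fun j _ => ?_
  rw [Finset.sum_subset hK fun k _ hk => by simp [Finsupp.notMem_support_iff.1 hk]]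

theorem sum_sq_norm_eq_of_support_subset {ι : Type*} (c : ι →₀ ℂ) {K : Finset ι}
    (hK : c.support ⊆ K) : ∑ k ∈ c.support, ‖c k‖ ^ 2 = ∑ k ∈ K, ‖c k‖ ^ 2 :=
  Finset.sum_subset hK fun k _ hk => by simp [Finsupp.notMem_support_iff.1 hk]

section Bounded

variable {d m : ℕ} {Ω : Set (Fin d → ℝ)} {K : Finset (Fin d → ℤ)}

theorem indicator_eq_zero_of_floor_notMem (hK : ∀ x ∈ Ω, (fun i => ⌊x i⌋) ∈ K)
    (f : (Fin d → ℝ) → ℂ) (x : Fin d → ℝ) (hx : (fun i => ⌊x i⌋) ∉ K) : Ω.indicator f x = 0 :=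
  Set.indicator_of_notMem (fun h => hx (hK x h)) f

theorem tsum_sq_setIntegral_mul_expChar (hΩ : MeasurableSet Ω) (hΩb : Bornology.IsBounded Ω)
    (hK : ∀ x ∈ Ω, (fun i => ⌊x i⌋) ∈ K) (a : Fin m → Fin d → ℝ) {f : (Fin d → ℝ) → ℂ}
    (hf : MemLp f 2 (volume.restrict Ω)) :
    ∑' p : Fin m × (Fin d → ℤ),
        ‖∫ x in Ω, f x * (starRingEnd ℂ) (expChar (a p.1 + fun i => (p.2 i : ℝ)) x)‖ ^ 2 =
      ∫ x in unitBox d, fiberNormSq a K fun k => Ω.indicator f (intShift k x) := by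
  have : IsFiniteMeasure (volume.restrict Ω) :=
    isFiniteMeasure_restrict.2 hΩb.measure_lt_top.ne
  rw [← tsum_sq_integral_mul_expChar ((memLp_indicator_iff_restrict hΩ).2 hf)
    ((integrable_indicator_iff hΩ).2 (hf.integrable one_le_two))
    (indicator_eq_zero_of_floor_notMem hK f) a]
  congr! 4 with p
  rw [← integral_indicator hΩ]
  simp only [Set.indicator_mul_left]

theorem setIntegral_sq_norm_eq_sum_intShift (hΩ : MeasurableSet Ω)
    (hK : ∀ x ∈ Ω, (fun i => ⌊x i⌋) ∈ K) {f : (Fin d → ℝ) → ℂ}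
    (hf : MemLp f 2 (volume.restrict Ω)) :
    ∫ x in Ω, ‖f x‖ ^ 2 = ∫ x in unitBox d, ∑ k ∈ K, ‖Ω.indicator f (intShift k x)‖ ^ 2 := by
  rw [← integral_sq_norm_eq_sum_intShift ((memLp_indicator_iff_restrict hΩ).2 hf)
    (indicator_eq_zero_of_floor_notMem hK f), ← integral_indicator hΩ]
  congr 1 with x
  by_cases hx : x ∈ Ω <;> simp [hx]

/-- The frame inequalities, expressed through the fibers of `f` over the unit box. -/
theorem isFrameWith_iff_integral_fiberNormSq (hΩ : MeasurableSet Ω)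
    (hΩb : Bornology.IsBounded Ω) (hK : ∀ x ∈ Ω, (fun i => ⌊x i⌋) ∈ K)
    (a : Fin m → Fin d → ℝ) (A B : ℝ) :
    IsFrameWith (volume.restrict Ω)
        (fun p : Fin m × (Fin d → ℤ) => expChar (a p.1 + fun i => (p.2 i : ℝ))) A B ↔
      ∀ f : (Fin d → ℝ) → ℂ, MemLp f 2 (volume.restrict Ω) →
        A * (∫ x in unitBox d, ∑ k ∈ K, ‖Ω.indicator f (intShift k x)‖ ^ 2) ≤
            (∫ x in unitBox d, fiberNormSq a K fun k => Ω.indicator f (intShift k x)) ∧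
          (∫ x in unitBox d, fiberNormSq a K fun k => Ω.indicator f (intShift k x)) ≤
            B * (∫ x in unitBox d, ∑ k ∈ K, ‖Ω.indicator f (intShift k x)‖ ^ 2) := by
  constructor
  · intro h f hf
    have h' := h (hf.toLp f)
    have hae : ∀ p : Fin m × (Fin d → ℤ),
        ∫ x in Ω, hf.toLp f x *
            (starRingEnd ℂ) (expChar (a p.1 + fun i => (p.2 i : ℝ)) x) =
          ∫ x in Ω, f x * (starRingEnd ℂ) (expChar (a p.1 + fun i => (p.2 i : ℝ)) x) :=
      fun p => integral_congr_ae (hf.coeFn_toLp.mono fun x hx => by simp only [hx])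
    simp_rw [hae] at h'
    rwa [tsum_sq_setIntegral_mul_expChar hΩ hΩb hK a hf, hf.norm_toLp_sq,
      setIntegral_sq_norm_eq_sum_intShift hΩ hK hf] at h'
  · intro h f
    have hf := Lp.memLp f
    have hn : ‖f‖ ^ 2 = ∫ x in Ω, ‖f x‖ ^ 2 := by
      rw [← hf.norm_toLp_sq, Lp.toLp_coeFn]
    rw [tsum_sq_setIntegral_mul_expChar hΩ hΩb hK a hf, hn,
      setIntegral_sq_norm_eq_sum_intShift hΩ hK hf]
    exact h f hf

/-- The function equal to `c k` on `E + k` for each integer vector `k`. -/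
noncomputable def fiberStep (E : Set (Fin d → ℝ)) (c : (Fin d → ℤ) → ℂ) : (Fin d → ℝ) → ℂ :=
  fun x => E.indicator (fun _ => c fun i => ⌊x i⌋) fun i => Int.fract (x i)

theorem fiberStep_intShift {E : Set (Fin d → ℝ)} (c : (Fin d → ℤ) → ℂ) {x : Fin d → ℝ}
    (hx : x ∈ unitBox d) (k : Fin d → ℤ) :
    fiberStep E c (intShift k x) = E.indicator (fun _ => c k) x := by
  have h1 : (fun i => Int.fract (intShift k x i)) = x := by
    ext i
    have := hx i trivial
    simpa [intShift] using Int.fract_eq_self.2 this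
  rw [fiberStep, h1, show (fun i => ⌊intShift k x i⌋) = k from floor_add_intCast_of_mem_unitBox hx k]

theorem measurable_fiberStep {E : Set (Fin d → ℝ)} (hE : MeasurableSet E)
    (c : (Fin d → ℤ) → ℂ) : Measurable (fiberStep E c) := by
  have hfr : Measurable fun x : Fin d → ℝ => fun i => Int.fract (x i) :=
    measurable_pi_lambda _ fun i => measurable_fract.comp (measurable_pi_apply i)
  exact ((measurable_of_countable c).comp (measurable_pi_floor d)).indicator (hfr hE)

theorem memLp_fiberStep {E : Set (Fin d → ℝ)} (hE : MeasurableSet E) (c : (Fin d → ℤ) →₀ ℂ)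
    (μ : Measure (Fin d → ℝ)) [IsFiniteMeasure μ] (p : ℝ≥0∞) : MemLp (fiberStep E c) p μ := by
  refine MemLp.of_bound (measurable_fiberStep hE c).aestronglyMeasurable
    (∑ k ∈ c.support, ‖c k‖) (.of_forall fun x => ?_)
  refine (norm_indicator_le_norm_self _ _).trans ?_
  by_cases hk : (fun i => ⌊x i⌋) ∈ c.support
  · exact Finset.single_le_sum (f := fun k => ‖c k‖) (fun _ _ => norm_nonneg _) hk
  · rw [Finsupp.notMem_support_iff.1 hk, norm_zero]
    positivity

end Bounded

theorem fiberNormSq_zero {d m : ℕ} (a : Fin m → Fin d → ℝ) (K : Finset (Fin d → ℤ)) :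
    fiberNormSq a K (fun _ => 0) = 0 := by simp [fiberNormSq]

/-- For a bounded measurable `Ω ⊆ ℝ^d` of positive measure, the exponentials
`e^{2πi⟨a_j + λ, ·⟩}` form a frame of `L²(Ω)` with frame bounds `A` and `B` iff for a.e.
`ω ∈ [0,1)^d` and every finitely supported `c : ℤ^d → ℂ` vanishing outside
`{k : ω + k ∈ Ω}` one has `A ∑ₖ |cₖ|² ≤ ∑ⱼ |∑ₖ cₖ e^{-2πi⟨a_j,k⟩}|² ≤ B ∑ₖ |cₖ|²`. -/
theorem frame_with_bounds_iff_fiber_bounds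
    (d m : ℕ) (Ω : Set (Fin d → ℝ)) (hΩmeas : MeasurableSet Ω)
    (hΩbdd : Bornology.IsBounded Ω) (hΩpos : 0 < volume Ω)
    (a : Fin m → (Fin d → ℝ)) (A B : ℝ) (hA : 0 < A) (hAB : A ≤ B) :
    IsFrameWith (volume.restrict Ω)
        (fun p : Fin m × (Fin d → ℤ) => expChar (a p.1 + fun i => (p.2 i : ℝ))) A B
      ↔ ∀ᵐ ω ∂(volume.restrict (unitBox d)),
          ∀ c : (Fin d → ℤ) →₀ ℂ,
            (∀ k : Fin d → ℤ, (fun i => ω i + (k i : ℝ)) ∉ Ω → c k = 0) →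
            A * (∑ k ∈ c.support, ‖c k‖ ^ 2) ≤
              (∑ j : Fin m, ‖∑ k ∈ c.support,
                c k * Complex.exp (-(2 * Real.pi * Complex.I * ∑ i, a j i * (k i : ℝ)))‖ ^ 2) ∧
            (∑ j : Fin m, ‖∑ k ∈ c.support,
                c k * Complex.exp (-(2 * Real.pi * Complex.I * ∑ i, a j i * (k i : ℝ)))‖ ^ 2)
              ≤ B * (∑ k ∈ c.support, ‖c k‖ ^ 2) := by
  change _ ↔ ∀ᵐ ω ∂(volume.restrict (unitBox d)), ∀ c : (Fin d → ℤ) →₀ ℂ,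
    (∀ k : Fin d → ℤ, intShift k ω ∉ Ω → c k = 0) →
      A * (∑ k ∈ c.support, ‖c k‖ ^ 2) ≤ fiberNormSq a c.support c ∧
        fiberNormSq a c.support c ≤ B * (∑ k ∈ c.support, ‖c k‖ ^ 2)
  obtain ⟨K, hK⟩ := exists_finset_floor_mem hΩbdd
  have : IsFiniteMeasure (volume.restrict Ω) :=
    isFiniteMeasure_restrict.2 hΩbdd.measure_lt_top.ne
  constructor
  · intro hframe
    have key : ∀ S : Finset (Fin d → ℤ), ∀ᵐ ω ∂(volume.restrict (unitBox d)),
        (∀ k ∈ S, intShift k ω ∈ Ω) → ∀ c : (Fin d → ℤ) →₀ ℂ, c.support = S →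
          A * (∑ k ∈ c.support, ‖c k‖ ^ 2) ≤ fiberNormSq a c.support c ∧
            fiberNormSq a c.support c ≤ B * (∑ k ∈ c.support, ‖c k‖ ^ 2) := by
      intro S
      set E : Set (Fin d → ℝ) := unitBox d ∩ ⋂ k ∈ S, intShift k ⁻¹' Ω with hE
      have hEm : MeasurableSet E := (measurableSet_unitBox d).inter <|
        Finset.measurableSet_biInter S fun k _ => (measurePreserving_intShift k).measurable hΩmeas
      have hEbox : E ⊆ unitBox d := Set.inter_subset_left
      rcases eq_or_ne (volume E) 0 with hE0 | hE0
      · have : ∀ᵐ ω ∂(volume.restrict (unitBox d)), ω ∉ E :=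
          ae_restrict_of_ae (measure_eq_zero_iff_ae_notMem.1 hE0)
        filter_upwards [this, ae_restrict_mem (measurableSet_unitBox d)] with ω h1 h2 h3
        exact absurd ⟨h2, Set.mem_iInter₂.2 h3⟩ h1
      · refine .of_forall fun ω _ c hc => ?_
        have hpos : 0 < volume.real E := ENNReal.toReal_pos hE0
          ((measure_mono hEbox).trans_lt (volume_unitBox_lt_top d)).ne
        have hind : ∀ x ∈ unitBox d, ∀ k,
            Ω.indicator (fiberStep E c) (intShift k x) = E.indicator (fun _ => c k) x := by
          intro x hx k
          rw [← fiberStep_intShift c hx k]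
          by_cases hkx : intShift k x ∈ Ω
          · rw [Set.indicator_of_mem hkx]
          · rw [Set.indicator_of_notMem hkx, fiberStep_intShift c hx k]
            by_cases hkS : k ∈ S
            · exact (Set.indicator_of_notMem
                (fun hxE : x ∈ E => hkx (Set.mem_iInter₂.1 hxE.2 k hkS)) _).symm
            · rw [Finsupp.notMem_support_iff.1 (hc ▸ hkS), Set.indicator_zero]
        have hsub : c.support ⊆ K ∪ S := hc ▸ Finset.subset_union_right
        have h := (isFrameWith_iff_integral_fiberNormSq hΩmeas hΩbdd
          (fun x hx => Finset.mem_union_left S (hK x hx)) a A B).1 hframe _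
            (memLp_fiberStep hEm c _ 2)
        have e1 : ∫ x in unitBox d, ∑ k ∈ K ∪ S,
            ‖Ω.indicator (fiberStep E c) (intShift k x)‖ ^ 2 =
              volume.real E * ∑ k ∈ c.support, ‖c k‖ ^ 2 := by
          rw [sum_sq_norm_eq_of_support_subset c hsub, ← smul_eq_mul, ← setIntegral_const,
            ← Set.inter_eq_self_of_subset_right hEbox, ← setIntegral_indicator hEm]
          refine setIntegral_congr_fun (measurableSet_unitBox d) fun x hx => ?_
          simp only [hind x hx, Set.inter_eq_self_of_subset_right hEbox]
          by_cases hxE : x ∈ E <;> simp [hxE]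
        have e2 : (∫ x in unitBox d, fiberNormSq a (K ∪ S) fun k =>
            Ω.indicator (fiberStep E c) (intShift k x)) =
              volume.real E * fiberNormSq a c.support c := by
          rw [fiberNormSq_eq_of_support_subset a c hsub, ← smul_eq_mul, ← setIntegral_const,
            ← Set.inter_eq_self_of_subset_right hEbox, ← setIntegral_indicator hEm]
          refine setIntegral_congr_fun (measurableSet_unitBox d) fun x hx => ?_
          simp only [hind x hx, Set.inter_eq_self_of_subset_right hEbox]
          by_cases hxE : x ∈ E <;> simp [hxE, fiberNormSq_zero]
        rw [e1, e2, mul_left_comm, mul_left_comm B] at h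
        exact ⟨le_of_mul_le_mul_left h.1 hpos, le_of_mul_le_mul_left h.2 hpos⟩
    filter_upwards [ae_all_iff.2 key] with ω hω c hc
    exact hω c.support (fun k hk => by_contra fun h => Finsupp.mem_support_iff.1 hk (hc k h)) c rfl
  · intro hfib
    rw [isFrameWith_iff_integral_fiberNormSq hΩmeas hΩbdd hK]
    intro f hf
    have hF := (memLp_indicator_iff_restrict hΩmeas).2 hf
    have i1 : IntegrableOn (fun x => ∑ k ∈ K, ‖Ω.indicator f (intShift k x)‖ ^ 2) (unitBox d) :=
      integrable_finsetSum _ fun k _ => (hF.comp_intShift k).norm.integrable_sq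
    have i2 := integrableOn_fiberNormSq hF K a
    have hpt : ∀ᵐ x ∂(volume.restrict (unitBox d)),
        A * (∑ k ∈ K, ‖Ω.indicator f (intShift k x)‖ ^ 2) ≤
            fiberNormSq a K (fun k => Ω.indicator f (intShift k x)) ∧
          fiberNormSq a K (fun k => Ω.indicator f (intShift k x)) ≤
            B * ∑ k ∈ K, ‖Ω.indicator f (intShift k x)‖ ^ 2 := by
      filter_upwards [hfib, ae_restrict_mem (measurableSet_unitBox d)] with x hx hxbox
      let c : (Fin d → ℤ) →₀ ℂ := Finsupp.onFinset K (fun k => Ω.indicator f (intShift k x))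
        fun k hk => by
          by_contra hkK
          refine hk (indicator_eq_zero_of_floor_notMem hK f _ ?_)
          rwa [show (fun i => ⌊intShift k x i⌋) = k from floor_add_intCast_of_mem_unitBox hxbox k]
      have hsub : c.support ⊆ K := Finsupp.support_onFinset_subset
      have h := hx c fun k hk => Set.indicator_of_notMem hk f
      rwa [fiberNormSq_eq_of_support_subset a c hsub,
        sum_sq_norm_eq_of_support_subset c hsub] at h
    rw [← integral_const_mul, ← integral_const_mul]
    exact ⟨integral_mono_ae (i1.const_mul A) i2 (hpt.mono fun x hx => hx.1),
      integral_mono_ae i2 (i1.const_mul B) (hpt.mono fun x hx => hx.2)⟩
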